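/- arXiv:1812.06608 — 2 statements merged into one kernel-verified Lean document; each statement's English description precedes it below -/
import Mathlib

section
/- Let Φ₁, Φ₂ be Young functions and u₁, u₂ submultiplicative weights on ℝⁿ with sup_{v ∈ ℝⁿ} u₁(v) < ∞, and suppose there exists g ∈ L_{Φ₂}^{u₂}(ℝⁿ) with g(y) ≠ 0 for every y ∈ ℝⁿ. If there exists a constant C > 0 such that ‖f‖_{L_{Φ₁}^{u₁}} ≤ C ‖f‖_{L_{Φ₂}^{u₂}} for every f ∈ L_{Φ₂}^{u₂}(ℝⁿ), then there exists C' > 0 such that u₁(x) ≤ C' u₂(x) for all x ∈ ℝⁿ. -/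
open MeasureTheory Filter
open scoped ENNReal

/-- A Young function: a convex function `Φ : [0,∞) → [0,∞)` (modelled on `ℝ`, with the
conditions imposed on `Set.Ici 0`) which is left-continuous, vanishes at `0`, tends to `0`
at `0⁺`, and tends to `∞` at `∞`. -/
structure IsYoungFunction (Φ : ℝ → ℝ) : Prop where
  convexOn : ConvexOn ℝ (Set.Ici 0) Φ
  map_zero : Φ 0 = 0
  nonneg : ∀ t, 0 ≤ t → 0 ≤ Φ t
  leftContinuous : ∀ t, 0 < t → ContinuousWithinAt Φ (Set.Iic t) t
  tendsto_zero : Tendsto Φ (nhdsWithin 0 (Set.Ioi 0)) (nhds 0)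
  tendsto_atTop : Tendsto Φ atTop atTop

/-- Generalized inverse `Φ⁻¹(s) = inf {r ≥ 0 : Φ r > s}`. -/
noncomputable def youngInv (Φ : ℝ → ℝ) (s : ℝ) : ℝ :=
  sInf {r : ℝ | 0 ≤ r ∧ s < Φ r}

/-- Weighted Orlicz (Luxemburg) norm, restricted to a measurable set `X ⊆ ℝⁿ`, valued in
`ℝ≥0∞` (with value `∞` if no admissible `b` exists):
`‖f‖ = inf {b > 0 : ∫_X Φ(|u x * f x| / b) dx ≤ 1}`. -/
noncomputable def orliczNormOn {n : ℕ} (Φ : ℝ → ℝ)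
    (u f : EuclideanSpace ℝ (Fin n) → ℝ) (X : Set (EuclideanSpace ℝ (Fin n))) : ℝ≥0∞ :=
  sInf {b : ℝ≥0∞ | 0 < b ∧ b < ⊤ ∧
    ∫⁻ x in X, ENNReal.ofReal (Φ (|u x * f x| / b.toReal)) ≤ 1}

/-- Weighted Orlicz (Luxemburg) norm on all of `ℝⁿ`. -/
noncomputable def orliczNorm {n : ℕ} (Φ : ℝ → ℝ)
    (u f : EuclideanSpace ℝ (Fin n) → ℝ) : ℝ≥0∞ :=
  orliczNormOn Φ u f Set.univ

/-- Membership in the weighted Orlicz space over `X`: `f` is measurable and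
`∫_X Φ(a * |u x * f x|) dx < ∞` for some `a > 0`. -/
def MemOrliczOn {n : ℕ} (Φ : ℝ → ℝ) (u f : EuclideanSpace ℝ (Fin n) → ℝ)
    (X : Set (EuclideanSpace ℝ (Fin n))) : Prop :=
  Measurable f ∧ ∃ a : ℝ, 0 < a ∧ ∫⁻ x in X, ENNReal.ofReal (Φ (a * |u x * f x|)) < ⊤

/-- Membership in the weighted Orlicz space `L_Φ^u(ℝⁿ)`. -/
def MemOrlicz {n : ℕ} (Φ : ℝ → ℝ) (u f : EuclideanSpace ℝ (Fin n) → ℝ) : Prop :=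
  MemOrliczOn Φ u f Set.univ

/-- A weight on `ℝⁿ`: a measurable, everywhere positive function. -/
def IsWeight {n : ℕ} (u : EuclideanSpace ℝ (Fin n) → ℝ) : Prop :=
  Measurable u ∧ ∀ x, 0 < u x

/-- A weight on a subset `X` of `ℝⁿ`: measurable and positive on `X`. -/
def IsWeightOn {n : ℕ} (u : EuclideanSpace ℝ (Fin n) → ℝ)
    (X : Set (EuclideanSpace ℝ (Fin n))) : Prop :=
  Measurable u ∧ ∀ x ∈ X, 0 < u x

/-- Weighted weak Orlicz norm, valued in `ℝ≥0∞`: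
`‖f‖ = inf {b > 0 : sup_{t>0} Φ(t) · λ({x : |u x * f x| / b > t}) ≤ 1}`. -/
noncomputable def weakOrliczNorm {n : ℕ} (Φ : ℝ → ℝ)
    (u f : EuclideanSpace ℝ (Fin n) → ℝ) : ℝ≥0∞ :=
  sInf {b : ℝ≥0∞ | 0 < b ∧ b < ⊤ ∧
    ∀ t : ℝ, 0 < t →
      ENNReal.ofReal (Φ t) * volume {x | t < |u x * f x| / b.toReal} ≤ 1}

/-- Membership in the weighted weak Orlicz space `wL_Φ^u(ℝⁿ)`. -/
def MemWeakOrlicz {n : ℕ} (Φ : ℝ → ℝ) (u f : EuclideanSpace ℝ (Fin n) → ℝ) : Prop :=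
  Measurable f ∧ weakOrliczNorm Φ u f < ⊤

/-- Weighted Lebesgue "norm" `(∫_X |u x * f x|^p dx)^(1/p)`, valued in `ℝ≥0∞`. -/
noncomputable def lebNormOn {n : ℕ} (p : ℝ)
    (u f : EuclideanSpace ℝ (Fin n) → ℝ) (X : Set (EuclideanSpace ℝ (Fin n))) : ℝ≥0∞ :=
  (∫⁻ x in X, ENNReal.ofReal (|u x * f x| ^ p)) ^ (1 / p)

/-- Membership in the weighted Lebesgue space `L_p^u(X)`. -/
def MemLebOn {n : ℕ} (p : ℝ) (u f : EuclideanSpace ℝ (Fin n) → ℝ)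
    (X : Set (EuclideanSpace ℝ (Fin n))) : Prop :=
  Measurable f ∧ lebNormOn p u f X < ⊤


namespace IsYoungFunction

lemma map_smul_le {Φ : ℝ → ℝ} (hΦ : IsYoungFunction Φ) {c t : ℝ} (hc : 0 ≤ c) (hc1 : c ≤ 1)
    (ht : 0 ≤ t) : Φ (c * t) ≤ c * Φ t := by
  have h := hΦ.convexOn.2 (Set.mem_Ici.2 ht) (Set.mem_Ici.2 le_rfl) hc (sub_nonneg.2 hc1)
    (by ring)
  simpa [hΦ.map_zero] using h

lemma mono {Φ : ℝ → ℝ} (hΦ : IsYoungFunction Φ) {s t : ℝ} (hs : 0 ≤ s) (hst : s ≤ t) :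
    Φ s ≤ Φ t := by
  rcases hs.eq_or_lt with rfl | hs'
  · rw [hΦ.map_zero]
    exact hΦ.nonneg t hst
  have ht : 0 < t := hs'.trans_le hst
  have hc1 : s / t ≤ 1 := (div_le_one ht).2 hst
  have h := hΦ.map_smul_le (div_nonneg hs ht.le) hc1 ht.le
  rw [div_mul_cancel₀ _ ht.ne'] at h
  exact h.trans (mul_le_of_le_one_left (hΦ.nonneg t ht.le) hc1)

end IsYoungFunction

/-- Every element of the Orlicz space has an admissible Luxemburg constant. -/
lemma MemOrlicz.exists_lintegral_le_one {n : ℕ} {Φ : ℝ → ℝ} (hΦ : IsYoungFunction Φ)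
    {u f : EuclideanSpace ℝ (Fin n) → ℝ} (hf : MemOrlicz Φ u f) :
    ∃ b : ℝ, 0 < b ∧ ∫⁻ x, ENNReal.ofReal (Φ (|u x * f x| / b)) ≤ 1 := by
  obtain ⟨-, a, ha, hI⟩ := hf
  rw [Measure.restrict_univ] at hI
  set I := ∫⁻ x, ENNReal.ofReal (Φ (a * |u x * f x|)) with hIdef
  set c : ℝ := (I.toReal + 1)⁻¹ with hc
  have hI0 : 0 ≤ I.toReal := ENNReal.toReal_nonneg
  have hc0 : 0 < c := by positivity
  have hc1 : c ≤ 1 := inv_le_one_of_one_le₀ (by linarith)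
  refine ⟨(c * a)⁻¹, by positivity, ?_⟩
  calc ∫⁻ x, ENNReal.ofReal (Φ (|u x * f x| / (c * a)⁻¹))
      ≤ ∫⁻ x, ENNReal.ofReal c * ENNReal.ofReal (Φ (a * |u x * f x|)) := by
        refine lintegral_mono fun x => ?_
        rw [← ENNReal.ofReal_mul hc0.le]
        refine ENNReal.ofReal_le_ofReal ?_
        rw [div_inv_eq_mul, show |u x * f x| * (c * a) = c * (a * |u x * f x|) by ring]
        exact hΦ.map_smul_le hc0.le hc1 (by positivity)
    _ = ENNReal.ofReal c * I := lintegral_const_mul' _ _ ENNReal.ofReal_ne_top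
    _ ≤ 1 := by
        rw [← ENNReal.ofReal_toReal hI.ne, ← ENNReal.ofReal_mul hc0.le, ← ENNReal.ofReal_one]
        refine ENNReal.ofReal_le_ofReal ?_
        rw [hc, inv_mul_le_iff₀ (by positivity)]
        linarith

/-- Translating by `x` multiplies an admissible Luxemburg constant by at most `u x`. -/
lemma lintegral_translate_le {n : ℕ} {Φ : ℝ → ℝ} (hΦ : IsYoungFunction Φ)
    {u g : EuclideanSpace ℝ (Fin n) → ℝ} (hu : IsWeight u)
    (hsub : ∀ x y : EuclideanSpace ℝ (Fin n), u (x + y) ≤ u x * u y) {b : ℝ} (hb : 0 < b)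
    (x : EuclideanSpace ℝ (Fin n)) :
    ∫⁻ y, ENNReal.ofReal (Φ (|u y * g (y - x)| / (u x * b))) ≤
      ∫⁻ y, ENNReal.ofReal (Φ (|u y * g y| / b)) := by
  rw [← lintegral_sub_right_eq_self (fun y => ENNReal.ofReal (Φ (|u y * g y| / b))) x]
  refine lintegral_mono fun y => ENNReal.ofReal_le_ofReal ?_
  have hx := hu.2 x
  refine hΦ.mono (by positivity) ?_
  rw [div_le_div_iff₀ (by positivity) hb, abs_mul, abs_mul, abs_of_pos (hu.2 y),
    abs_of_pos (hu.2 (y - x))]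
  have h := hsub x (y - x)
  rw [add_sub_cancel] at h
  calc u y * |g (y - x)| * b ≤ u x * u (y - x) * |g (y - x)| * b := by gcongr
    _ = u (y - x) * |g (y - x)| * (u x * b) := by ring

/-- For a bounded submultiplicative weight `u`, the norms of the translates of a nonvanishing
function are bounded below by a multiple of `u`. -/
lemma exists_mul_le_orliczNorm_translate {n : ℕ} {Φ : ℝ → ℝ} (hΦ : IsYoungFunction Φ)
    {u g : EuclideanSpace ℝ (Fin n) → ℝ} (hu : IsWeight u)
    (hsub : ∀ x y : EuclideanSpace ℝ (Fin n), u (x + y) ≤ u x * u y)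
    (hbdd : ∃ M : ℝ, ∀ v : EuclideanSpace ℝ (Fin n), u v ≤ M)
    (hg : Measurable g) (hgne : ∀ y, g y ≠ 0) :
    ∃ δ : ℝ, 0 < δ ∧ ∀ x : EuclideanSpace ℝ (Fin n),
      ENNReal.ofReal (δ * u x) ≤ orliczNorm Φ u (fun y => g (y - x)) := by
  obtain ⟨M, hM⟩ := hbdd
  have hM0 : 0 < M := (hu.2 0).trans_le (hM 0)
  obtain ⟨k, hk⟩ : ∃ k : ℕ,
      0 < volume {y : EuclideanSpace ℝ (Fin n) | 1 / ((k : ℝ) + 1) < |g y|} := by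
    refine exists_measure_pos_of_not_measure_iUnion_null fun h0 => ?_
    have hU : ⋃ k : ℕ, {y : EuclideanSpace ℝ (Fin n) | 1 / ((k : ℝ) + 1) < |g y|} = Set.univ :=
      Set.eq_univ_of_forall fun y =>
        Set.mem_iUnion.2 (exists_nat_one_div_lt (abs_pos.2 (hgne y)))
    rw [hU, Measure.measure_univ_eq_zero] at h0
    exact NeZero.ne _ h0
  set ε : ℝ := 1 / ((k : ℝ) + 1)
  have hε : 0 < ε := Nat.one_div_pos_of_nat
  set S := {y : EuclideanSpace ℝ (Fin n) | ε < |g y|}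
  have hS : MeasurableSet S := measurableSet_lt measurable_const hg.abs
  obtain ⟨K, hK⟩ : ∃ K : ℝ, 1 < ENNReal.ofReal K * volume S := by
    refine ⟨(volume S)⁻¹.toReal + 1, ?_⟩
    rw [← ENNReal.div_lt_iff (Or.inl hk.ne') (Or.inr ENNReal.one_ne_top), one_div,
      ENNReal.lt_ofReal_iff_toReal_lt (ENNReal.inv_ne_top.2 hk.ne')]
    exact lt_add_one _
  obtain ⟨T, hT⟩ := eventually_atTop.1 (hΦ.tendsto_atTop.eventually_ge_atTop K)
  set R : ℝ := max T 1
  have hR : 0 < R := lt_max_of_lt_right one_pos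
  refine ⟨ε / (M * R), by positivity, fun x => le_sInf ?_⟩
  rintro b ⟨hb0, hbt, hb⟩
  rw [Measure.restrict_univ] at hb
  have hb' : 0 < b.toReal := ENNReal.toReal_pos hb0.ne' hbt.ne
  by_contra! hlt
  rw [ENNReal.lt_ofReal_iff_toReal_lt hbt.ne, div_mul_eq_mul_div,
    lt_div_iff₀ (by positivity)] at hlt
  refine absurd hb (not_le.2 (hK.trans_le ?_))
  rw [← lintegral_add_right_eq_self (fun y =>
    ENNReal.ofReal (Φ (|u y * g (y - x)| / b.toReal))) x, ← setLIntegral_const]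
  refine (setLIntegral_mono' hS fun y hy => ENNReal.ofReal_le_ofReal (hT _ ?_)).trans
    (setLIntegral_le_lintegral S _)
  refine (le_max_left T 1).trans ?_
  rw [le_div_iff₀ hb', add_sub_cancel_right, abs_mul, abs_of_pos (hu.2 _)]
  have h := hsub (y + x) (-y)
  rw [add_neg_cancel_comm] at h
  have hux : u x ≤ u (y + x) * M := h.trans (mul_le_mul_of_nonneg_left (hM _) (hu.2 _).le)
  have hpos := hu.2 x
  have hy' : ε ≤ |g y| := le_of_lt hy
  refine le_of_mul_le_mul_right ?_ hM0
  calc R * b.toReal * M = b.toReal * (M * R) := by ring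
    _ ≤ ε * u x := hlt.le
    _ ≤ |g y| * (u (y + x) * M) := by gcongr
    _ = u (y + x) * |g y| * M := by ring

/-- under the stated hypotheses, the norm inequality between the weighted
Orlicz spaces forces the weight inequality `u₁ ⪯ u₂`. -/
theorem stmt11 {n : ℕ} (Φ₁ Φ₂ : ℝ → ℝ)
    (h₁ : IsYoungFunction Φ₁) (h₂ : IsYoungFunction Φ₂)
    (u₁ u₂ : EuclideanSpace ℝ (Fin n) → ℝ) (hu₁ : IsWeight u₁) (hu₂ : IsWeight u₂)
    (hsub₁ : ∀ x y : EuclideanSpace ℝ (Fin n), u₁ (x + y) ≤ u₁ x * u₁ y)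
    (hsub₂ : ∀ x y : EuclideanSpace ℝ (Fin n), u₂ (x + y) ≤ u₂ x * u₂ y)
    (hbdd : ∃ M : ℝ, ∀ v : EuclideanSpace ℝ (Fin n), u₁ v ≤ M)
    (g : EuclideanSpace ℝ (Fin n) → ℝ) (hg : MemOrlicz Φ₂ u₂ g)
    (hgne : ∀ y : EuclideanSpace ℝ (Fin n), g y ≠ 0)
    (C : ℝ) (hC : 0 < C)
    (h : ∀ f : EuclideanSpace ℝ (Fin n) → ℝ, MemOrlicz Φ₂ u₂ f →
      orliczNorm Φ₁ u₁ f ≤ ENNReal.ofReal C * orliczNorm Φ₂ u₂ f) :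
    ∃ C' : ℝ, 0 < C' ∧ ∀ x : EuclideanSpace ℝ (Fin n), u₁ x ≤ C' * u₂ x := by
  obtain ⟨b, hb, hgb⟩ := hg.exists_lintegral_le_one h₂
  obtain ⟨δ, hδ, hlow⟩ := exists_mul_le_orliczNorm_translate h₁ hu₁ hsub₁ hbdd hg.1 hgne
  refine ⟨C * b / δ, by positivity, fun x => ?_⟩
  have hx := hu₂.2 x
  have hub : 0 < u₂ x * b := by positivity
  have hle : ∫⁻ y, ENNReal.ofReal (Φ₂ (|u₂ y * g (y - x)| / (u₂ x * b))) ≤ 1 :=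
    (lintegral_translate_le h₂ hu₂ hsub₂ hb x).trans hgb
  have hmem : MemOrlicz Φ₂ u₂ (fun y => g (y - x)) := by
    refine ⟨hg.1.comp (measurable_id.sub_const x), (u₂ x * b)⁻¹, inv_pos.2 hub, ?_⟩
    simp only [Measure.restrict_univ, ← div_eq_inv_mul]
    exact hle.trans_lt ENNReal.one_lt_top
  have hup : orliczNorm Φ₂ u₂ (fun y => g (y - x)) ≤ ENNReal.ofReal (u₂ x * b) := by
    refine sInf_le ⟨ENNReal.ofReal_pos.2 hub, ENNReal.ofReal_lt_top, ?_⟩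
    rw [Measure.restrict_univ, ENNReal.toReal_ofReal hub.le]
    exact hle
  have key := ((hlow x).trans (h _ hmem)).trans (mul_le_mul_right hup _)
  rw [← ENNReal.ofReal_mul hC.le, ENNReal.ofReal_le_ofReal_iff (by positivity)] at key
  rw [div_mul_eq_mul_div, le_div_iff₀ hδ]
  linarith
end

section
/- Let Φ be a continuous Young function satisfying the Δ₂ condition (there exists K > 0 with Φ(2t) ≤ K Φ(t) for all t ≥ 0), and let u₁, u₂ be submultiplicative weights on ℝⁿ with sup_{v ∈ ℝⁿ} u₁(v) < ∞ such that there exists g ∈ L_{Φ}^{u₂}(ℝⁿ) with g(y) ≠ 0 for every y ∈ ℝⁿ. Then the following are equivalent: (1) there exists C > 0 with u₁(x) ≤ C u₂(x) for all x ∈ ℝⁿ; (2) L_{Φ}^{u₂}(ℝⁿ) ⊆ L_{Φ}^{u₁}(ℝⁿ); (3) there exists C > 0 such that ‖f‖_{L_{Φ}^{u₁}} ≤ C ‖f‖_{L_{Φ}^{u₂}} for every f ∈ L_{Φ}^{u₂}(ℝⁿ). -/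
open MeasureTheory Filter
open scoped ENNReal

namespace IsYoungFunction

variable {Φ : ℝ → ℝ}

theorem map_mul_le (hΦ : IsYoungFunction Φ) {ε t : ℝ} (hε : 0 ≤ ε) (hε' : ε ≤ 1) (ht : 0 ≤ t) :
    Φ (ε * t) ≤ ε * Φ t := by
  have h := hΦ.convexOn.2 (Set.mem_Ici.2 ht) (Set.mem_Ici.2 le_rfl) hε (sub_nonneg.2 hε')
    (by ring)
  simpa [hΦ.map_zero] using h

theorem monotoneOn (hΦ : IsYoungFunction Φ) : MonotoneOn Φ (Set.Ici 0) := by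
  intro s hs t ht hst
  rw [Set.mem_Ici] at hs ht
  rcases ht.eq_or_lt with rfl | ht'
  · rw [le_antisymm hst hs]
  · have h := hΦ.map_mul_le (div_nonneg hs ht) ((div_le_one ht').2 hst) ht
    rw [div_mul_cancel₀ _ ht'.ne'] at h
    exact h.trans (mul_le_of_le_one_left (hΦ.nonneg t ht) ((div_le_one ht').2 hst))

end IsYoungFunction

section

variable {n : ℕ} {Φ : ℝ → ℝ} {u₁ u₂ : EuclideanSpace ℝ (Fin n) → ℝ}

theorem orliczNorm_lt_top_of_memOrlicz (hΦ : IsYoungFunction Φ)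
    {u f : EuclideanSpace ℝ (Fin n) → ℝ} (hf : MemOrlicz Φ u f) : orliczNorm Φ u f < ⊤ := by
  obtain ⟨-, a, ha, hfin⟩ := hf
  rw [Measure.restrict_univ] at hfin
  set I := ∫⁻ x, ENNReal.ofReal (Φ (a * |u x * f x|)) with hI
  set ε : ℝ := (I.toReal + 1)⁻¹ with hε
  have hI0 : 0 ≤ I.toReal := ENNReal.toReal_nonneg
  have hε0 : 0 < ε := by positivity
  have hε1 : ε ≤ 1 := inv_le_one_of_one_le₀ (by linarith)
  have hεI : ENNReal.ofReal ε * I ≤ 1 := by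
    rw [← ENNReal.ofReal_toReal hfin.ne, ← ENNReal.ofReal_mul hε0.le, ENNReal.ofReal_le_one, hε,
      inv_mul_le_iff₀ (by positivity)]
    linarith
  refine lt_of_le_of_lt (sInf_le ⟨ENNReal.ofReal_pos.2 (inv_pos.2 (mul_pos hε0 ha)),
    ENNReal.ofReal_lt_top, ?_⟩) (ENNReal.ofReal_lt_top (r := (ε * a)⁻¹))
  rw [Measure.restrict_univ, ENNReal.toReal_ofReal (by positivity)]
  calc ∫⁻ x, ENNReal.ofReal (Φ (|u x * f x| / (ε * a)⁻¹))
      ≤ ∫⁻ x, ENNReal.ofReal ε * ENNReal.ofReal (Φ (a * |u x * f x|)) := by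
        refine lintegral_mono fun x => ?_
        rw [← ENNReal.ofReal_mul hε0.le]
        refine ENNReal.ofReal_le_ofReal ?_
        rw [show |u x * f x| / (ε * a)⁻¹ = ε * (a * |u x * f x|) by rw [div_inv_eq_mul]; ring]
        exact hΦ.map_mul_le hε0.le hε1 (by positivity)
    _ = ENNReal.ofReal ε * I := lintegral_const_mul' _ _ ENNReal.ofReal_ne_top
    _ ≤ 1 := hεI

theorem memOrlicz_of_orliczNorm_lt_top {u f : EuclideanSpace ℝ (Fin n) → ℝ} (hf : Measurable f)
    (h : orliczNorm Φ u f < ⊤) : MemOrlicz Φ u f := by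
  obtain ⟨b, ⟨hb0, hbt, hb⟩, -⟩ := sInf_lt_iff.1 h
  refine ⟨hf, b.toReal⁻¹, inv_pos.2 (ENNReal.toReal_pos hb0.ne' hbt.ne), ?_⟩
  simp_rw [inv_mul_eq_div]
  exact hb.trans_lt ENNReal.one_lt_top

theorem orliczNorm_le_mul_of_weight_le (hΦ : IsYoungFunction Φ) (hu₁ : ∀ x, 0 < u₁ x)
    {C : ℝ} (hC : 0 < C) (h : ∀ x, u₁ x ≤ C * u₂ x) (f : EuclideanSpace ℝ (Fin n) → ℝ) :
    orliczNorm Φ u₁ f ≤ ENNReal.ofReal C * orliczNorm Φ u₂ f := by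
  have hC0 : ENNReal.ofReal C ≠ 0 := (ENNReal.ofReal_pos.2 hC).ne'
  rw [mul_comm, ← ENNReal.div_le_iff_le_mul (Or.inl hC0) (Or.inl ENNReal.ofReal_ne_top)]
  refine le_sInf fun b ⟨hb0, hbt, hb⟩ => ?_
  rw [ENNReal.div_le_iff_le_mul (Or.inl hC0) (Or.inl ENNReal.ofReal_ne_top)]
  have hb' : 0 < b.toReal := ENNReal.toReal_pos hb0.ne' hbt.ne
  refine sInf_le ⟨ENNReal.mul_pos hb0.ne' hC0, ENNReal.mul_lt_top hbt ENNReal.ofReal_lt_top,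
    le_trans (lintegral_mono fun x => ENNReal.ofReal_le_ofReal ?_) hb⟩
  rw [ENNReal.toReal_mul, ENNReal.toReal_ofReal hC.le]
  refine hΦ.monotoneOn (Set.mem_Ici.2 (by positivity)) (Set.mem_Ici.2 (by positivity)) ?_
  rw [div_le_div_iff₀ (by positivity) hb', abs_mul, abs_mul, abs_of_pos (hu₁ x)]
  calc u₁ x * |f x| * b.toReal ≤ (C * |u₂ x|) * |f x| * b.toReal := by
        gcongr
        exact (h x).trans (by gcongr; exact le_abs_self _)
    _ = |u₂ x| * |f x| * (b.toReal * C) := by ring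

theorem exists_finite_pos_measure_weights_le (hu₁ : Measurable u₁) (hu₂ : Measurable u₂) :
    ∃ D : ℝ, 0 < D ∧ ∃ E : Set (EuclideanSpace ℝ (Fin n)), MeasurableSet E ∧ volume E ≠ 0 ∧
      volume E ≠ ⊤ ∧ ∀ e ∈ E, u₁ (-e) ≤ D ∧ u₂ e ≤ D := by
  let E : ℕ → Set (EuclideanSpace ℝ (Fin n)) := fun N =>
    {e | u₁ (-e) ≤ N} ∩ {e | u₂ e ≤ N} ∩ Metric.closedBall 0 N
  have hE : ∃ N, volume (E N) ≠ 0 := by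
    by_contra! hc
    have hU : ⋃ N, E N = Set.univ := by
      refine Set.eq_univ_of_forall fun e => Set.mem_iUnion.2 ?_
      obtain ⟨N, hN⟩ := exists_nat_ge (max (max (u₁ (-e)) (u₂ e)) ‖e‖)
      simp only [max_le_iff] at hN
      exact ⟨N, ⟨hN.1.1, hN.1.2⟩, by simpa using hN.2⟩
    have h0 := measure_iUnion_null hc
    rw [hU] at h0
    exact NeZero.ne _ (Measure.measure_univ_eq_zero.1 h0)
  obtain ⟨N, hN⟩ := hE
  refine ⟨N + 1, by positivity, E N, ?_, hN, ?_, fun e he =>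
    ⟨le_trans he.1.1 (by simp), le_trans he.1.2 (by simp)⟩⟩
  · exact ((measurableSet_le (hu₁.comp measurable_neg) measurable_const).inter
      (measurableSet_le hu₂ measurable_const)).inter measurableSet_closedBall
  · exact ((measure_mono Set.inter_subset_right).trans_lt measure_closedBall_lt_top).ne

theorem exists_weight_le_of_memOrlicz_imp (hΦ : IsYoungFunction Φ)
    (hu₁ : IsWeight u₁) (hu₂ : IsWeight u₂)
    (hsub₁ : ∀ x y, u₁ (x + y) ≤ u₁ x * u₁ y) (hsub₂ : ∀ x y, u₂ (x + y) ≤ u₂ x * u₂ y)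
    (h : ∀ f, MemOrlicz Φ u₂ f → MemOrlicz Φ u₁ f) :
    ∃ C : ℝ, 0 < C ∧ ∀ x, u₁ x ≤ C * u₂ x := by
  obtain ⟨D, hD, E, hEm, hE0, hEt, hE⟩ := exists_finite_pos_measure_weights_le hu₁.1 hu₂.1
  by_contra! hc
  choose x hx using fun k : ℕ => hc ((k + 1) * 2 ^ (k + 1)) (by positivity)
  let S : ℕ → Set (EuclideanSpace ℝ (Fin n)) := fun k => (fun y => y - x k) ⁻¹' E
  have hSm : ∀ k, MeasurableSet (S k) := fun k => hEm.preimage (measurable_sub_const _)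
  have hSv : ∀ k, volume (S k) = volume E := fun k => by
    simp only [S, sub_eq_add_neg]
    exact measure_preimage_add_right _ _ _
  let H : EuclideanSpace ℝ (Fin n) → ℝ≥0∞ := fun y =>
    ∑' k, (S k).indicator (fun _ => (2⁻¹ : ℝ≥0∞) ^ (k + 1)) y
  have hsum : ∑' k : ℕ, (2⁻¹ : ℝ≥0∞) ^ (k + 1) = 1 := by
    rw [ENNReal.tsum_geometric_add_one, ENNReal.one_sub_inv_two, inv_inv,
      ENNReal.inv_mul_cancel (by simp) (by simp)]
  have hH1 : ∀ y, H y ≤ 1 := fun y =>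
    (ENNReal.tsum_le_tsum fun k => Set.indicator_le_self _ _ y).trans hsum.le
  have hHt : ∀ y, H y ≠ ⊤ := fun y => ((hH1 y).trans_lt ENNReal.one_lt_top).ne
  have hHm : Measurable H :=
    Measurable.tsum fun k => measurable_const.indicator (hSm k)
  have hHint : ∫⁻ y, H y = volume E := by
    rw [lintegral_tsum fun k => (measurable_const.indicator (hSm k)).aemeasurable]
    simp_rw [lintegral_indicator_const (hSm _), hSv]
    rw [ENNReal.tsum_mul_right, hsum, one_mul]
  have hmem : MemOrlicz Φ u₂ fun y => (H y).toReal / u₂ y := by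
    refine ⟨hHm.ennreal_toReal.div hu₂.1, 1, one_pos, ?_⟩
    rw [Measure.restrict_univ]
    calc ∫⁻ y, ENNReal.ofReal (Φ (1 * |u₂ y * ((H y).toReal / u₂ y)|))
        ≤ ∫⁻ y, ENNReal.ofReal (Φ 1) * H y := by
          refine lintegral_mono fun y => ?_
          have hy1 : (H y).toReal ≤ 1 :=
            ENNReal.toReal_le_of_le_ofReal zero_le_one (by simpa using hH1 y)
          rw [one_mul, mul_div_cancel₀ _ (hu₂.2 y).ne', abs_of_nonneg ENNReal.toReal_nonneg]
          have hle := hΦ.map_mul_le ENNReal.toReal_nonneg hy1 zero_le_one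
          rw [mul_one] at hle
          calc ENNReal.ofReal (Φ (H y).toReal) ≤ ENNReal.ofReal ((H y).toReal * Φ 1) :=
                ENNReal.ofReal_le_ofReal hle
            _ = ENNReal.ofReal (Φ 1) * H y := by
                rw [ENNReal.ofReal_mul ENNReal.toReal_nonneg, ENNReal.ofReal_toReal (hHt y),
                  mul_comm]
      _ = ENNReal.ofReal (Φ 1) * volume E := by
          rw [lintegral_const_mul _ hHm, hHint]
      _ < ⊤ := ENNReal.mul_lt_top ENNReal.ofReal_lt_top hEt.lt_top
  obtain ⟨-, a, ha, hfin⟩ := h _ hmem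
  rw [Measure.restrict_univ] at hfin
  have hlow : ∀ k : ℕ, ∀ y ∈ S k, ((k : ℝ) + 1) / D ^ 2 ≤ u₁ y * ((H y).toReal / u₂ y) := by
    intro k y hy
    obtain ⟨hy₁, hy₂⟩ := hE _ hy
    have h₁ : u₁ (x k) ≤ u₁ y * D := by
      have := hsub₁ y (-(y - x k))
      rw [show y + -(y - x k) = x k by abel] at this
      exact this.trans (mul_le_mul_of_nonneg_left hy₁ (hu₁.2 y).le)
    have h₂ : u₂ y ≤ u₂ (x k) * D := by
      have := hsub₂ (x k) (y - x k)
      rw [add_sub_cancel] at this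
      exact this.trans (mul_le_mul_of_nonneg_left hy₂ (hu₂.2 _).le)
    have h₃ : (2⁻¹ : ℝ) ^ (k + 1) ≤ (H y).toReal := by
      have hle : (2⁻¹ : ℝ≥0∞) ^ (k + 1) ≤ H y := by
        refine le_trans ?_ (ENNReal.le_tsum k)
        rw [Set.indicator_of_mem hy]
      have := ENNReal.toReal_mono (hHt y) hle
      simpa using this
    have hyp := hu₂.2 y
    have h₄ : ((k : ℝ) + 1) * 2 ^ (k + 1) * u₂ y ≤ u₁ y * D ^ 2 :=
      calc ((k : ℝ) + 1) * 2 ^ (k + 1) * u₂ y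
          ≤ ((k : ℝ) + 1) * 2 ^ (k + 1) * (u₂ (x k) * D) := by gcongr
        _ = ((k : ℝ) + 1) * 2 ^ (k + 1) * u₂ (x k) * D := by ring
        _ ≤ u₁ (x k) * D := mul_le_mul_of_nonneg_right (hx k).le hD.le
        _ ≤ u₁ y * D * D := mul_le_mul_of_nonneg_right h₁ hD.le
        _ = u₁ y * D ^ 2 := by ring
    rw [← mul_div_assoc, div_le_div_iff₀ (by positivity) hyp]
    calc ((k : ℝ) + 1) * u₂ y
        = (((k : ℝ) + 1) * 2 ^ (k + 1) * u₂ y) * 2⁻¹ ^ (k + 1) := by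
          rw [inv_pow]; field_simp
      _ ≤ (u₁ y * D ^ 2) * (H y).toReal := by
          have := hu₁.2 y
          gcongr
      _ = u₁ y * (H y).toReal * D ^ 2 := by ring
  have hbound : ∀ k : ℕ, ENNReal.ofReal (Φ (a * (((k : ℝ) + 1) / D ^ 2))) * volume E ≤
      ∫⁻ y, ENNReal.ofReal (Φ (a * |u₁ y * ((H y).toReal / u₂ y)|)) := by
    intro k
    rw [← hSv k, ← setLIntegral_const]
    refine (setLIntegral_mono' (hSm k) fun y hy => ENNReal.ofReal_le_ofReal ?_).trans
      (setLIntegral_le_lintegral (S k) _)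
    refine hΦ.monotoneOn (Set.mem_Ici.2 (by positivity)) (Set.mem_Ici.2 (by positivity)) ?_
    gcongr
    exact (hlow k y hy).trans (le_abs_self _)
  have harg : Tendsto (fun k : ℕ => a * (((k : ℝ) + 1) / D ^ 2)) atTop atTop :=
    ((tendsto_natCast_atTop_atTop.atTop_add tendsto_const_nhds).atTop_div_const
      (by positivity)).const_mul_atTop ha
  have hlim := ENNReal.Tendsto.mul_const
    (ENNReal.tendsto_ofReal_atTop.comp (hΦ.tendsto_atTop.comp harg))
    (Or.inl ENNReal.top_ne_zero) (b := volume E)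
  rw [ENNReal.top_mul hE0] at hlim
  exact hfin.ne (top_le_iff.1 (le_of_tendsto' hlim hbound))

end

/-- Osançliol: for a continuous Young function `Φ` satisfying the `Δ₂`
condition and submultiplicative weights (with `u₁` bounded and a nowhere-vanishing
`g ∈ L_Φ^{u₂}(ℝⁿ)`), equivalence of (1) `u₁ ⪯ u₂`, (2) `L_Φ^{u₂} ⊆ L_Φ^{u₁}`, and
(3) the norm inequality. -/
theorem stmt13 {n : ℕ} (Φ : ℝ → ℝ) (hΦ : IsYoungFunction Φ)
    (hcont : ContinuousOn Φ (Set.Ici 0))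
    (hΔ₂ : ∃ K : ℝ, 0 < K ∧ ∀ t : ℝ, 0 ≤ t → Φ (2 * t) ≤ K * Φ t)
    (u₁ u₂ : EuclideanSpace ℝ (Fin n) → ℝ) (hu₁ : IsWeight u₁) (hu₂ : IsWeight u₂)
    (hsub₁ : ∀ x y : EuclideanSpace ℝ (Fin n), u₁ (x + y) ≤ u₁ x * u₁ y)
    (hsub₂ : ∀ x y : EuclideanSpace ℝ (Fin n), u₂ (x + y) ≤ u₂ x * u₂ y)
    (hbdd : ∃ M : ℝ, ∀ v : EuclideanSpace ℝ (Fin n), u₁ v ≤ M)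
    (hg : ∃ g : EuclideanSpace ℝ (Fin n) → ℝ, MemOrlicz Φ u₂ g ∧
      ∀ y : EuclideanSpace ℝ (Fin n), g y ≠ 0) :
    ((∃ C : ℝ, 0 < C ∧ ∀ x : EuclideanSpace ℝ (Fin n), u₁ x ≤ C * u₂ x) ↔
      (∀ f : EuclideanSpace ℝ (Fin n) → ℝ, MemOrlicz Φ u₂ f → MemOrlicz Φ u₁ f)) ∧
    ((∃ C : ℝ, 0 < C ∧ ∀ x : EuclideanSpace ℝ (Fin n), u₁ x ≤ C * u₂ x) ↔
      (∃ C : ℝ, 0 < C ∧ ∀ f : EuclideanSpace ℝ (Fin n) → ℝ, MemOrlicz Φ u₂ f →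
        orliczNorm Φ u₁ f ≤ ENNReal.ofReal C * orliczNorm Φ u₂ f)) := by
  have h13 (h : ∃ C : ℝ, 0 < C ∧ ∀ x, u₁ x ≤ C * u₂ x) :
      ∃ C : ℝ, 0 < C ∧ ∀ f : EuclideanSpace ℝ (Fin n) → ℝ, MemOrlicz Φ u₂ f →
        orliczNorm Φ u₁ f ≤ ENNReal.ofReal C * orliczNorm Φ u₂ f := by
    obtain ⟨C, hC, hle⟩ := h
    exact ⟨C, hC, fun f _ => orliczNorm_le_mul_of_weight_le hΦ hu₁.2 hC hle f⟩
  have h32 (h : ∃ C : ℝ, 0 < C ∧ ∀ f : EuclideanSpace ℝ (Fin n) → ℝ, MemOrlicz Φ u₂ f →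
        orliczNorm Φ u₁ f ≤ ENNReal.ofReal C * orliczNorm Φ u₂ f) :
      ∀ f : EuclideanSpace ℝ (Fin n) → ℝ, MemOrlicz Φ u₂ f → MemOrlicz Φ u₁ f := by
    obtain ⟨C, -, hle⟩ := h
    exact fun f hf => memOrlicz_of_orliczNorm_lt_top hf.1 ((hle f hf).trans_lt
      (ENNReal.mul_lt_top ENNReal.ofReal_lt_top (orliczNorm_lt_top_of_memOrlicz hΦ hf)))
  have h21 := exists_weight_le_of_memOrlicz_imp hΦ hu₁ hu₂ hsub₁ hsub₂
  exact ⟨⟨fun h => h32 (h13 h), h21⟩, ⟨h13, fun h => h21 (h32 h)⟩⟩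
end
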